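/- Let T be a triangulation of the completed ∞-gon and let θ ∈ T. Then θ is mutable in T if and only if θ is not the generic curve z, θ is not an adic curve α_m with T having a left fountain at m, and θ is not a Prüfer curve π_m with T having a right fountain at m. -/

import Mathlib

open scoped Classical

/-- Vertices of the completed ∞-gon: `ℤ ∪ {−∞, +∞}` with the extended linear order. -/
abbrev Vtx : Type := WithBot (WithTop ℤ)

/-- The vertex corresponding to an integer. -/
def vInt (m : ℤ) : Vtx := ((m : WithTop ℤ) : Vtx)

/-- The vertex `+∞`. -/
def vTop : Vtx := ((⊤ : WithTop ℤ) : Vtx)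

/-- The vertex `−∞`. -/
def vBot : Vtx := (⊥ : Vtx)

/-- An arc of the completed ∞-gon: a pair of vertices `src < tgt` such that if both
endpoints are integers then they differ by at least `2`. -/
structure Arc where
  src : Vtx
  tgt : Vtx
  lt : src < tgt
  sep : ∀ m n : ℤ, src = vInt m → tgt = vInt n → m + 2 ≤ n

/-- Two arcs `(a,b)` and `(c,d)` cross if `a < c < b < d` or `c < a < d < b`. -/
def Cross (x y : Arc) : Prop :=
  (x.src < y.src ∧ y.src < x.tgt ∧ x.tgt < y.tgt) ∨
  (y.src < x.src ∧ x.src < y.tgt ∧ y.tgt < x.tgt)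

/-- A triangulation of the completed ∞-gon: a maximal set of pairwise compatible
(= non-crossing) arcs. -/
def IsTriangulation (T : Set Arc) : Prop :=
  (∀ x ∈ T, ∀ y ∈ T, ¬ Cross x y) ∧
  ∀ γ : Arc, (∀ x ∈ T, ¬ Cross γ x) → γ ∈ T

lemma vInt_lt_vTop (m : ℤ) : vInt m < vTop := by
  simpa [vInt, vTop] using WithBot.coe_lt_coe.mpr (WithTop.coe_lt_top (m : ℤ))

lemma vBot_lt_vInt (m : ℤ) : vBot < vInt m := WithBot.bot_lt_coe _

lemma vBot_lt_vTop : vBot < vTop := WithBot.bot_lt_coe _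

lemma vTop_ne_vInt (n : ℤ) : vTop ≠ vInt n := by simp [vTop, vInt]

lemma vBot_ne_vInt (n : ℤ) : vBot ≠ vInt n := by simp [vBot, vInt]

/-- The Prüfer curve `π_m = (m, +∞)`. -/
def prufer (m : ℤ) : Arc :=
  ⟨vInt m, vTop, vInt_lt_vTop m, fun _ n _ h => absurd h (vTop_ne_vInt n)⟩

/-- The adic curve `α_m = (−∞, m)`. -/
def adic (m : ℤ) : Arc :=
  ⟨vBot, vInt m, vBot_lt_vInt m, fun k _ h _ => absurd h (vBot_ne_vInt k)⟩

/-- The generic curve `z = (−∞, +∞)`. -/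
def generic : Arc :=
  ⟨vBot, vTop, vBot_lt_vTop, fun k _ h _ => absurd h (vBot_ne_vInt k)⟩

/-- `T` contains an arc with endpoints `x` and `y`. -/
def HasArc (T : Set Arc) (x y : Vtx) : Prop := ∃ γ ∈ T, γ.src = x ∧ γ.tgt = y

/-- `T` has a right fountain at the integer `n`. -/
def RightFountainInt (T : Set Arc) (n : ℤ) : Prop :=
  {p : ℤ | HasArc T (vInt n) (vInt p)}.Infinite

/-- `T` has a left fountain at the integer `n`. -/
def LeftFountainInt (T : Set Arc) (n : ℤ) : Prop :=
  {p : ℤ | HasArc T (vInt p) (vInt n)}.Infinite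

/-- `T` has a right fountain at the vertex `v`. -/
def RightFountain (T : Set Arc) (v : Vtx) : Prop :=
  (∃ n : ℤ, v = vInt n ∧ RightFountainInt T n) ∨
  (v = vTop ∧ {p : ℤ | 0 ≤ p ∧ prufer p ∈ T}.Infinite) ∨
  (v = vBot ∧ {p : ℤ | 0 ≤ p ∧ adic p ∈ T}.Infinite)

/-- `T` has a left fountain at the vertex `v`. -/
def LeftFountain (T : Set Arc) (v : Vtx) : Prop :=
  (∃ n : ℤ, v = vInt n ∧ LeftFountainInt T n) ∨
  (v = vTop ∧ {p : ℤ | p ≤ 0 ∧ prufer p ∈ T}.Infinite) ∨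
  (v = vBot ∧ {p : ℤ | p ≤ 0 ∧ adic p ∈ T}.Infinite)

/-- `T` is locally finite if every vertex is an endpoint of only finitely many arcs of `T`. -/
def LocallyFin (T : Set Arc) : Prop :=
  ∀ v : Vtx, {γ | γ ∈ T ∧ (γ.src = v ∨ γ.tgt = v)}.Finite

/-- An arc is peripheral if both endpoints are integers. -/
def IsPeripheral (γ : Arc) : Prop :=
  (∃ m : ℤ, γ.src = vInt m) ∧ ∃ n : ℤ, γ.tgt = vInt n

/-- `γ'` is an exchange partner for `γ` relative to `T`:
it is distinct from `γ` and `(T \ {γ}) ∪ {γ'}` is again a triangulation. -/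
def MutExchange (T : Set Arc) (γ γ' : Arc) : Prop :=
  γ' ≠ γ ∧ IsTriangulation ((T \ {γ}) ∪ {γ'})

/-- `γ` is a mutable arc of `T`. -/
def IsMutable (T : Set Arc) (γ : Arc) : Prop :=
  γ ∈ T ∧ ∃ γ', MutExchange T γ γ'

/-- The (unique) replacement arc of `γ` in `T`, when `γ` is mutable. -/
noncomputable def flipArc (T : Set Arc) (γ : Arc) : Arc :=
  if h : ∃ γ', MutExchange T γ γ' then h.choose else γ

/-- The mutation `μ_γ(T)` of `T` at `γ`. -/
noncomputable def mutate (T : Set Arc) (γ : Arc) : Set Arc :=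
  (T \ {γ}) ∪ {flipArc T γ}

/-- `μ_γ(δ)`: the effect of the mutation of `T` at `γ` on the arc `δ`. -/
noncomputable def mutArc (T : Set Arc) (γ δ : Arc) : Arc :=
  if δ = γ then flipArc T γ else δ

/-- One step of a mutation sequence on a set of arcs (`none` = no entry). -/
noncomputable def stepT (T : Set Arc) : Option Arc → Set Arc
  | none => T
  | some γ => mutate T γ

/-- One step of a mutation sequence on a single arc. -/
noncomputable def stepA (T : Set Arc) : Option Arc → Arc → Arc
  | none, δ => δ
  | some γ, δ => mutArc T γ δ

/-- `iterT T θ k` is `μ_{θ_k} ∘ ⋯ ∘ μ_{θ_1}(T)`. Sequences (finite or infinite) are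
encoded as `θ : ℕ → Option Arc` whose support is downward closed. -/
noncomputable def iterT (T : Set Arc) (θ : ℕ → Option Arc) : ℕ → Set Arc
  | 0 => T
  | k + 1 => stepT (iterT T θ k) (θ k)

/-- `iterA T θ γ k` is `μ_{θ_k} ∘ ⋯ ∘ μ_{θ_1}(γ)`. -/
noncomputable def iterA (T : Set Arc) (θ : ℕ → Option Arc) (γ : Arc) : ℕ → Arc
  | 0 => γ
  | k + 1 => stepA (iterT T θ k) (θ k) (iterA T θ γ k)

/-- `θ` is a `T`-admissible sequence: its support is downward closed (so it is a genuine
finite or infinite sequence), each entry is mutable in the triangulation obtained by the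
previous mutations, and the mutation of each arc of `T` along `θ` eventually stabilizes. -/
def Admissible (T : Set Arc) (θ : ℕ → Option Arc) : Prop :=
  (∀ i, θ i = none → θ (i + 1) = none) ∧
  (∀ i γ, θ i = some γ → IsMutable (iterT T θ i) γ) ∧
  (∀ γ ∈ T, ∃ l, ∀ k, l ≤ k → iterA T θ γ k = iterA T θ γ l)

/-- `μ_θ(γ)`: the stable value of the mutation of the arc `γ` along the sequence `θ`. -/
noncomputable def seqLimit (T : Set Arc) (θ : ℕ → Option Arc) (γ : Arc) : Arc :=
  if h : ∃ l, ∀ k, l ≤ k → iterA T θ γ k = iterA T θ γ l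
  then iterA T θ γ h.choose else γ

/-- `μ_θ(T)`: the mutation of `T` along the sequence `θ`. -/
noncomputable def mutSeq (T : Set Arc) (θ : ℕ → Option Arc) : Set Arc :=
  seqLimit T θ '' T

/-- The sequence `θ` leaves the arc `γ` untouched. -/
def Untouched (T : Set Arc) (θ : ℕ → Option Arc) (γ : Arc) : Prop :=
  ∀ l, iterA T θ γ l = γ

/-- The quadrilateral `S(γ)` of a mutable arc `γ` in `T`: with `v₁ < v₂ < v₃ < v₄` the four
endpoints of the two diagonals `γ` and `flipArc T γ`, it consists of those of the pairs
`(v₁,v₂), (v₂,v₃), (v₃,v₄), (v₁,v₄)` that are arcs. -/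
noncomputable def quad (T : Set Arc) (γ : Arc) : Set Arc :=
  let γ' := flipArc T γ
  let vs : Vtx × Vtx × Vtx × Vtx :=
    if γ.src < γ'.src then (γ.src, γ'.src, γ.tgt, γ'.tgt) else (γ'.src, γ.src, γ'.tgt, γ.tgt)
  {δ : Arc | (δ.src = vs.1 ∧ δ.tgt = vs.2.1) ∨ (δ.src = vs.2.1 ∧ δ.tgt = vs.2.2.1) ∨
    (δ.src = vs.2.2.1 ∧ δ.tgt = vs.2.2.2) ∨ (δ.src = vs.1 ∧ δ.tgt = vs.2.2.2)}

/-- The set `𝒫` of Prüfer curves compatible with every arc of `S`. -/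
def pruferCompletion (S : Set Arc) : Set Arc :=
  {γ | (∃ k : ℤ, γ = prufer k) ∧ ∀ x ∈ S, ¬ Cross γ x}

/-- The set `𝒜̃` of adic curves compatible with every arc of `S ∪ 𝒫(S)`. -/
def adicCompletion' (S : Set Arc) : Set Arc :=
  {γ | (∃ k : ℤ, γ = adic k) ∧ ∀ x ∈ S ∪ pruferCompletion S, ¬ Cross γ x}

/-- The completed (Prüfer) mutation `μ̄_θ(T) = μ_θ(T) ∪ 𝒫 ∪ 𝒜̃` of `T` along `θ`. -/
noncomputable def completedMut (T : Set Arc) (θ : ℕ → Option Arc) : Set Arc :=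
  mutSeq T θ ∪ pruferCompletion (mutSeq T θ) ∪ adicCompletion' (mutSeq T θ)

/-- The tower of triangulations associated to a composition of completed mutations. -/
noncomputable def compIter (T : Set Arc) (Θ : ℕ → Option (ℕ → Option Arc)) : ℕ → Set Arc
  | 0 => T
  | k + 1 =>
    match Θ k with
    | none => compIter T Θ k
    | some θ => completedMut (compIter T Θ k) θ

/-- `Θ` is a `T`-admissible composition of completed mutations. -/
def CompAdmissible (T : Set Arc) (Θ : ℕ → Option (ℕ → Option Arc)) : Prop :=
  (∀ i, Θ i = none → Θ (i + 1) = none) ∧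
  ∀ i θ, Θ i = some θ → Admissible (compIter T Θ i) θ

/-- The transfinite mutation of `T` along the composition `Θ`. -/
noncomputable def transfiniteMut (T : Set Arc) (Θ : ℕ → Option (ℕ → Option Arc)) : Set Arc :=
  ⋃ i, {γ ∈ compIter T Θ i |
    ∀ k, i ≤ k → ∀ θ, Θ k = some θ → Untouched (compIter T Θ k) θ γ}

/-- Crossing of pairs of vertices. -/
def CrV (x y e f : Vtx) : Prop := (x < e ∧ e < y ∧ y < f) ∨ (e < x ∧ x < f ∧ f < y)

/-- The pair `(x,y)` is crossed by no arc of `T`. -/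
def Sd (T : Set Arc) (x y : Vtx) : Prop := x < y ∧ ∀ γ ∈ T, ¬ CrV x y γ.src γ.tgt

lemma vtx_cases (v : Vtx) : v = vBot ∨ v = vTop ∨ ∃ n : ℤ, v = vInt n := by
  induction v using WithBot.recBotCoe with
  | bot => left; rfl
  | coe v =>
    induction v using WithTop.recTopCoe with
    | top => right; left; rfl
    | coe n => right; right; exact ⟨n, rfl⟩

lemma vInt_lt (m n : ℤ) : vInt m < vInt n ↔ m < n := by
  simp [vInt]

lemma vBot_le (v : Vtx) : vBot ≤ v := bot_le

lemma le_vTop (v : Vtx) : v ≤ vTop := by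
  rcases vtx_cases v with rfl | rfl | ⟨n, rfl⟩
  · exact vBot_lt_vTop.le
  · exact le_rfl
  · exact (vInt_lt_vTop n).le

lemma arc_ext {x y : Arc} (h1 : x.src = y.src) (h2 : x.tgt = y.tgt) : x = y := by
  cases x; cases y; simp_all

lemma int_of_between {x y v : Vtx} (h1 : x < v) (h2 : v < y) : ∃ n : ℤ, v = vInt n := by
  rcases vtx_cases v with rfl | rfl | h
  · exact absurd h1 (not_lt.mpr (vBot_le x))
  · exact absurd h2 (not_lt.mpr (le_vTop y))
  · exact h

lemma exists_min (m : ℤ) (S : Set Vtx) (hS : S.Nonempty) (hb : ∀ v ∈ S, vInt m < v) :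
    ∃ v ∈ S, ∀ w ∈ S, v ≤ w := by
  by_cases h : ∃ n : ℤ, vInt n ∈ S
  · obtain ⟨l, hl, hmin⟩ := Int.exists_least_of_bdd (P := fun n => vInt n ∈ S)
      ⟨m, fun z hz => ((vInt_lt _ _).1 (hb _ hz)).le⟩ h
    refine ⟨vInt l, hl, fun w hw => ?_⟩
    rcases vtx_cases w with rfl | rfl | ⟨n, rfl⟩
    · exact absurd (hb _ hw) (not_lt.mpr (vBot_le _))
    · exact le_vTop _
    · have := hmin n hw
      rw [← not_lt, vInt_lt]; omega
  · obtain ⟨v, hv⟩ := hS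
    refine ⟨v, hv, fun w hw => ?_⟩
    rcases vtx_cases w with rfl | rfl | ⟨n, rfl⟩
    · exact absurd (hb _ hw) (not_lt.mpr (vBot_le _))
    · exact le_vTop _
    · exact absurd ⟨n, hw⟩ h

lemma exists_max (m : ℤ) (S : Set Vtx) (hS : S.Nonempty) (hb : ∀ v ∈ S, v < vInt m) :
    ∃ v ∈ S, ∀ w ∈ S, w ≤ v := by
  by_cases h : ∃ n : ℤ, vInt n ∈ S
  · obtain ⟨l, hl, hmax⟩ := Int.exists_greatest_of_bdd (P := fun n => vInt n ∈ S)
      ⟨m, fun z hz => ((vInt_lt _ _).1 (hb _ hz)).le⟩ h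
    refine ⟨vInt l, hl, fun w hw => ?_⟩
    rcases vtx_cases w with rfl | rfl | ⟨n, rfl⟩
    · exact vBot_le _
    · exact absurd (hb _ hw) (not_lt.mpr (le_vTop _))
    · have := hmax n hw
      rw [← not_lt, vInt_lt]; omega
  · obtain ⟨v, hv⟩ := hS
    refine ⟨v, hv, fun w hw => ?_⟩
    rcases vtx_cases w with rfl | rfl | ⟨n, rfl⟩
    · exact vBot_le _
    · exact absurd (hb _ hw) (not_lt.mpr (le_vTop _))
    · exact absurd ⟨n, hw⟩ h

lemma cross_iff (x y : Arc) : Cross x y ↔ CrV x.src x.tgt y.src y.tgt := Iff.rfl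

lemma crV_symm {x y e f : Vtx} : CrV x y e f ↔ CrV e f x y := by
  unfold CrV; tauto

lemma sd_of_mem {T : Set Arc} (hT : IsTriangulation T) {γ : Arc} (h : γ ∈ T) :
    Sd T γ.src γ.tgt := ⟨γ.lt, fun x hx => hT.1 γ h x hx⟩

lemma not_crV_succ (n : ℤ) (γ : Arc) : ¬ CrV (vInt n) (vInt (n+1)) γ.src γ.tgt := by
  rintro (⟨h1, h2, _⟩ | ⟨_, h1, h2⟩) <;>
  · obtain ⟨k, hk⟩ := int_of_between h1 h2
    rw [hk, vInt_lt] at h1 h2; omega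

lemma sd_succ (T : Set Arc) (n : ℤ) : Sd T (vInt n) (vInt (n+1)) :=
  ⟨(vInt_lt _ _).2 (by omega), fun γ _ => not_crV_succ n γ⟩

lemma sd_cases {T : Set Arc} (hT : IsTriangulation T) {x y : Vtx} (h : Sd T x y) :
    HasArc T x y ∨ ∃ n : ℤ, x = vInt n ∧ y = vInt (n+1) := by
  by_cases hs : ∃ m n : ℤ, x = vInt m ∧ y = vInt n ∧ ¬ (m + 2 ≤ n)
  · obtain ⟨m, n, rfl, rfl, hmn⟩ := hs
    have := (vInt_lt _ _).1 h.1
    right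
    exact ⟨m, rfl, by congr 1; omega⟩
  · left
    push Not at hs
    exact ⟨⟨x, y, h.1, fun m n h1 h2 => hs m n h1 h2⟩, hT.2 _ h.2, rfl, rfl⟩

lemma sd_generic (T : Set Arc) : Sd T vBot vTop := by
  refine ⟨vBot_lt_vTop, fun γ _ => ?_⟩
  have h1 := vBot_le γ.src
  have h2 := le_vTop γ.tgt
  unfold CrV
  grind

/-- a side of the quadrilateral is not crossed by arcs compatible with `T \ {θ}` -/
lemma side_ok {T : Set Arc} (hT : IsTriangulation T) {θ δ : Arc} {x y : Vtx} (h : Sd T x y)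
    (hne : x ≠ θ.src ∨ y ≠ θ.tgt) (hδ : ∀ γ ∈ T, γ ≠ θ → ¬ Cross δ γ) :
    ¬ CrV x y δ.src δ.tgt := by
  rcases sd_cases hT h with ⟨γ, hγ, rfl, rfl⟩ | ⟨n, rfl, rfl⟩
  · rw [crV_symm]
    refine hδ γ hγ ?_
    rintro rfl
    simp at hne
  · exact not_crV_succ n δ

lemma mutable_of {T : Set Arc} (hT : IsTriangulation T) {θ γ' : Arc} (hθ : θ ∈ T)
    (hc : Cross θ γ') (h1 : ∀ γ ∈ T, γ ≠ θ → ¬ Cross γ' γ)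
    (h2 : ∀ δ : Arc, Cross θ δ → (∀ γ ∈ T, γ ≠ θ → ¬ Cross δ γ) → δ = γ') : IsMutable T θ := by
  refine ⟨hθ, γ', ?_, ?_, ?_⟩
  · rintro rfl
    exact hT.1 _ hθ _ hθ hc
  · rintro x (⟨hx, hx'⟩ | rfl) y (⟨hy, hy'⟩ | rfl)
    · exact hT.1 x hx y hy
    · rw [cross_iff, crV_symm]; exact h1 x hx hx'
    · exact h1 y hy hy'
    · simp only [Cross]; grind
  · intro δ hδ
    have hδ' : ∀ γ ∈ T, γ ≠ θ → ¬ Cross δ γ := fun γ hγ hne => hδ γ (Or.inl ⟨hγ, hne⟩)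
    by_cases hcr : Cross θ δ
    · right; exact h2 δ hcr hδ'
    · left
      refine ⟨hT.2 δ fun x hx => ?_, ?_⟩
      · by_cases hxθ : x = θ
        · subst hxθ; rw [cross_iff, crV_symm]; exact hcr
        · exact hδ' x hx hxθ
      · rintro rfl
        exact hδ γ' (Or.inr rfl) hc

lemma flip_right {T : Set Arc} (hT : IsTriangulation T) {θ : Arc} (hθ : θ ∈ T) {c d : Vtx}
    (hac : Sd T θ.src c) (hcb : Sd T c θ.tgt) (hbd : Sd T θ.tgt d) (had : Sd T θ.src d) :
    IsMutable T θ := by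
  have l1 := hac.1
  have l2 := hcb.1
  have l3 := hbd.1
  refine mutable_of hT (γ' := ⟨c, d, l2.trans l3, ?_⟩) hθ ?_ ?_ ?_
  · rintro m n rfl rfl
    obtain ⟨k, hk⟩ := int_of_between l2 l3
    rw [hk, vInt_lt] at l2 l3; omega
  · left; exact ⟨l1, l2, l3⟩
  · intro γ hγ hne hx
    have k1 := hac.2 γ hγ
    have k2 := hcb.2 γ hγ
    have k3 := hbd.2 γ hγ
    have k4 := had.2 γ hγ
    have k5 : ¬ (γ.src = θ.src ∧ γ.tgt = θ.tgt) := fun h => hne (arc_ext h.1 h.2)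
    simp only [Cross, CrV] at *
    clear hne hγ hT hac hcb hbd had
    have := γ.lt
    grind
  · intro δ hx hδ
    have k1 := side_ok hT hac (Or.inr l2.ne) hδ
    have k2 := side_ok hT hcb (Or.inl l1.ne') hδ
    have k3 := side_ok hT hbd (Or.inl (l1.trans l2).ne') hδ
    have k4 := side_ok hT had (Or.inr l3.ne') hδ
    have : δ.src = c ∧ δ.tgt = d := by
      simp only [Cross, CrV] at *
      clear hT hac hcb hbd had hδ
      have := δ.lt
      grind
    exact arc_ext this.1 this.2

lemma flip_left {T : Set Arc} (hT : IsTriangulation T) {θ : Arc} (hθ : θ ∈ T) {c d : Vtx}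
    (hac : Sd T θ.src c) (hcb : Sd T c θ.tgt) (hda : Sd T d θ.src) (hdb : Sd T d θ.tgt) :
    IsMutable T θ := by
  have l1 := hac.1
  have l2 := hcb.1
  have l3 := hda.1
  refine mutable_of hT (γ' := ⟨d, c, l3.trans l1, ?_⟩) hθ ?_ ?_ ?_
  · rintro m n rfl rfl
    obtain ⟨k, hk⟩ := int_of_between l3 l1
    rw [hk, vInt_lt] at l1 l3; omega
  · right; exact ⟨l3, l1, l2⟩
  · intro γ hγ hne hx
    have k1 := hac.2 γ hγ
    have k2 := hcb.2 γ hγ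
    have k3 := hda.2 γ hγ
    have k4 := hdb.2 γ hγ
    have k5 : ¬ (γ.src = θ.src ∧ γ.tgt = θ.tgt) := fun h => hne (arc_ext h.1 h.2)
    simp only [Cross, CrV] at *
    clear hne hγ hT hac hcb hda hdb
    have := γ.lt
    grind
  · intro δ hx hδ
    have k1 := side_ok hT hac (Or.inr l2.ne) hδ
    have k2 := side_ok hT hcb (Or.inl l1.ne') hδ
    have k3 := side_ok hT hda (Or.inr (l1.trans l2).ne) hδ
    have k4 := side_ok hT hdb (Or.inl l3.ne) hδ
    have : δ.src = d ∧ δ.tgt = c := by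
      simp only [Cross, CrV] at *
      clear hT hac hcb hda hdb hδ
      have := δ.lt
      grind
    exact arc_ext this.1 this.2

/-- inner triangle from a maximal `c` -/
lemma inner_max {T : Set Arc} (hT : IsTriangulation T) {a b c : Vtx} (hab : Sd T a b)
    (hac : Sd T a c) (hcb : c < b) (hmax : ∀ w, Sd T a w → w < b → w ≤ c) : Sd T c b := by
  refine ⟨hcb, fun γ hγ hx => ?_⟩
  have k1 := hab.2 γ hγ
  have k2 := hac.2 γ hγ
  have k3 := hac.1
  by_cases h : γ.src = a
  · have := hmax γ.tgt (h ▸ sd_of_mem hT hγ)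
    simp only [CrV] at *
    clear hab hac hmax
    grind
  · simp only [CrV] at *
    clear hab hac hmax
    grind

lemma inner_min {T : Set Arc} (hT : IsTriangulation T) {a b c : Vtx} (hab : Sd T a b)
    (hcb : Sd T c b) (hac : a < c) (hmin : ∀ w, Sd T w b → a < w → c ≤ w) : Sd T a c := by
  refine ⟨hac, fun γ hγ hx => ?_⟩
  have k1 := hab.2 γ hγ
  have k2 := hcb.2 γ hγ
  have k3 := hcb.1
  by_cases h : γ.tgt = b
  · have := hmin γ.src (h ▸ sd_of_mem hT hγ)
    simp only [CrV] at *
    clear hab hcb hmin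
    grind
  · simp only [CrV] at *
    clear hab hcb hmin
    grind

lemma outer_right {T : Set Arc} (hT : IsTriangulation T) {a : Vtx} {m : ℤ}
    (hab : Sd T a (vInt m)) (h : ∃ d, vInt m < d ∧ Sd T a d) :
    ∃ d, Sd T (vInt m) d ∧ Sd T a d := by
  obtain ⟨d, ⟨hd1, hd2⟩, hmin⟩ := exists_min m {d | vInt m < d ∧ Sd T a d} h (fun v hv => hv.1)
  refine ⟨d, ⟨hd1, fun γ hγ hx => ?_⟩, hd2⟩
  have k1 := hab.2 γ hγ
  have k2 := hd2.2 γ hγ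
  have k3 := hab.1
  by_cases h' : γ.src = a
  · have : vInt m < γ.tgt → d ≤ γ.tgt := fun h3 => hmin γ.tgt ⟨h3, h' ▸ sd_of_mem hT hγ⟩
    simp only [CrV] at *
    clear hab hd2 hmin h
    grind
  · simp only [CrV] at *
    clear hab hd2 hmin h
    grind

lemma outer_left {T : Set Arc} (hT : IsTriangulation T) {b : Vtx} {m : ℤ}
    (hab : Sd T (vInt m) b) (h : ∃ d, d < vInt m ∧ Sd T d b) :
    ∃ d, Sd T d (vInt m) ∧ Sd T d b := by
  obtain ⟨d, ⟨hd1, hd2⟩, hmax⟩ := exists_max m {d | d < vInt m ∧ Sd T d b} h (fun v hv => hv.1)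
  refine ⟨d, ⟨hd1, fun γ hγ hx => ?_⟩, hd2⟩
  have k1 := hab.2 γ hγ
  have k2 := hd2.2 γ hγ
  have k3 := hab.1
  by_cases h' : γ.tgt = b
  · have : γ.src < vInt m → γ.src ≤ d := fun h3 => hmax γ.src ⟨h3, h' ▸ sd_of_mem hT hγ⟩
    simp only [CrV] at *
    clear hab hd2 hmax h
    grind
  · simp only [CrV] at *
    clear hab hd2 hmax h
    grind

lemma outer_exists {T : Set Arc} (hT : IsTriangulation T) {a m : ℤ}
    (hab : Sd T (vInt a) (vInt m)) :
    (∃ d, d < vInt a ∧ Sd T d (vInt m)) ∨ (∃ d, vInt m < d ∧ Sd T (vInt a) d) := by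
  by_contra hcon
  push Not at hcon
  obtain ⟨hc1, hc2⟩ := hcon
  obtain ⟨f, ⟨hf1, e, he1, he2⟩, hmin⟩ := exists_min m
    {f | vInt m < f ∧ ∃ e, e < vInt a ∧ Sd T e f}
    ⟨vTop, vInt_lt_vTop m, vBot, vBot_lt_vInt a, sd_generic T⟩ (fun v hv => hv.1)
  refine hc2 f hf1 ⟨hab.1.trans hf1, fun γ hγ hx => ?_⟩
  have k1 := hab.2 γ hγ
  have k2 := he2.2 γ hγ
  have k3 := hab.1
  have k4 : γ.tgt = vInt m → ¬ γ.src < vInt a :=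
    fun h3 h4 => hc1 γ.src h4 (h3 ▸ sd_of_mem hT hγ)
  have k5 : vInt m < γ.tgt → γ.src < vInt a → f ≤ γ.tgt :=
    fun h3 h4 => hmin γ.tgt ⟨h3, γ.src, h4, sd_of_mem hT hγ⟩
  simp only [CrV] at *
  clear hab he2 hmin hc1 hc2
  grind

lemma inner_right {T : Set Arc} (hT : IsTriangulation T) {m : ℤ} {b : Vtx}
    (hab : Sd T (vInt m) b) (hb : vInt (m+1) < b)
    (hfin : ∃ N : ℤ, ∀ n : ℤ, Sd T (vInt m) (vInt n) → vInt n < b → n ≤ N) :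
    ∃ c, Sd T (vInt m) c ∧ Sd T c b := by
  obtain ⟨N, hN⟩ := hfin
  obtain ⟨l, ⟨hl1, hl2⟩, hmax⟩ := Int.exists_greatest_of_bdd
    (P := fun n => Sd T (vInt m) (vInt n) ∧ vInt n < b)
    ⟨N, fun n hn => hN n hn.1 hn.2⟩ ⟨m+1, sd_succ T m, hb⟩
  refine ⟨vInt l, hl1, inner_max hT hab hl1 hl2 fun w hw1 hw2 => ?_⟩
  obtain ⟨n, rfl⟩ := int_of_between hw1.1 hw2
  have := hmax n ⟨hw1, hw2⟩
  rw [← not_lt, vInt_lt]; omega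

lemma inner_left {T : Set Arc} (hT : IsTriangulation T) {m : ℤ} {a : Vtx}
    (hab : Sd T a (vInt m)) (ha : a < vInt (m-1))
    (hfin : ∃ N : ℤ, ∀ n : ℤ, Sd T (vInt n) (vInt m) → a < vInt n → N ≤ n) :
    ∃ c, Sd T a c ∧ Sd T c (vInt m) := by
  obtain ⟨N, hN⟩ := hfin
  obtain ⟨l, ⟨hl1, hl2⟩, hmin⟩ := Int.exists_least_of_bdd
    (P := fun n => Sd T (vInt n) (vInt m) ∧ a < vInt n)
    ⟨N, fun n hn => hN n hn.1 hn.2⟩ ⟨m-1, by simpa using sd_succ T (m-1), ha⟩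
  refine ⟨vInt l, inner_min hT hab hl1 hl2 fun w hw1 hw2 => ?_, hl1⟩
  obtain ⟨n, rfl⟩ := int_of_between hw2 hw1.1
  have := hmin n ⟨hw1, hw2⟩
  rw [← not_lt, vInt_lt]; omega

lemma vInt_inj {m n : ℤ} (h : vInt m = vInt n) : m = n := by
  simpa [vInt] using h

/-- the exchange partner crosses the original arc and nothing else -/
lemma exch_cross {T : Set Arc} (hT : IsTriangulation T) {θ γ' : Arc} (hθ : θ ∈ T)
    (h : MutExchange T θ γ') : Cross θ γ' ∧ ∀ γ ∈ T, γ ≠ θ → ¬ Cross γ γ' := by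
  obtain ⟨hne, h1, h2⟩ := h
  refine ⟨?_, fun γ hγ hγn => h1 γ (Or.inl ⟨hγ, hγn⟩) γ' (Or.inr rfl)⟩
  by_contra hc
  have : θ ∈ (T \ {θ}) ∪ {γ'} := by
    refine h2 θ ?_
    rintro x (⟨hx, _⟩ | rfl)
    · exact hT.1 θ hθ x hx
    · exact hc
  rcases this with ⟨_, h3⟩ | h3
  · exact h3 rfl
  · exact hne h3.symm

/-- An arc `θ` of a triangulation `T` of the completed ∞-gon is mutable if and only if it is
not the generic curve, not an adic curve `α_m` with a left fountain at `m` in `T`, and not a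
Prüfer curve `π_m` with a right fountain at `m` in `T`. -/
theorem statement5 (T : Set Arc) (hT : IsTriangulation T) (θ : Arc) (hθ : θ ∈ T) :
    IsMutable T θ ↔
      (θ ≠ generic ∧ (∀ m : ℤ, θ = adic m → ¬ LeftFountainInt T m) ∧
        ∀ m : ℤ, θ = prufer m → ¬ RightFountainInt T m) := by
  constructor
  · rintro ⟨-, γ', hγ'⟩
    obtain ⟨hc, hn⟩ := exch_cross hT hθ hγ'
    refine ⟨?_, ?_, ?_⟩
    · rintro rfl
      exact (sd_generic {γ'}).2 γ' rfl hc
    · rintro m rfl hF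
      have hc' : vBot < γ'.src ∧ γ'.src < vInt m ∧ vInt m < γ'.tgt := by
        rcases hc with h | ⟨h, _⟩
        · exact h
        · exact absurd h (not_lt.mpr (vBot_le _))
      obtain ⟨c, hcs⟩ := int_of_between hc'.1 hc'.2.1
      have : ∃ p : ℤ, p < c ∧ HasArc T (vInt p) (vInt m) := by
        by_contra hcon
        push Not at hcon
        refine hF ((Set.finite_Icc c m).subset fun p hp => ⟨?_, ?_⟩)
        · by_contra hlt
          exact hcon p (by omega) hp
        · obtain ⟨γ, _, h1, h2⟩ := hp
          have := γ.sep p m h1 h2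
          omega
      obtain ⟨p, hp, γ, hγ, h1, h2⟩ := this
      refine hn γ hγ ?_ (Or.inl ?_)
      · rintro rfl
        exact vBot_ne_vInt p h1
      · rw [h1, h2, hcs, vInt_lt]
        exact ⟨hp, hcs ▸ hc'.2.1, hc'.2.2⟩
    · rintro m rfl hF
      have hc' : γ'.src < vInt m ∧ vInt m < γ'.tgt ∧ γ'.tgt < vTop := by
        rcases hc with ⟨_, _, h⟩ | h
        · exact absurd h (not_lt.mpr (le_vTop _))
        · exact h
      obtain ⟨c, hcs⟩ := int_of_between hc'.2.1 hc'.2.2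
      have : ∃ p : ℤ, c < p ∧ HasArc T (vInt m) (vInt p) := by
        by_contra hcon
        push Not at hcon
        refine hF ((Set.finite_Icc m c).subset fun p hp => ⟨?_, ?_⟩)
        · obtain ⟨γ, _, h1, h2⟩ := hp
          have := γ.sep m p h1 h2
          omega
        · by_contra hlt
          exact hcon p (by omega) hp
      obtain ⟨p, hp, γ, hγ, h1, h2⟩ := this
      refine hn γ hγ ?_ (Or.inr ?_)
      · rintro rfl
        exact vTop_ne_vInt p h2
      · rw [h1, h2]
        exact ⟨hc'.1, hc'.2.1, by rw [hcs, vInt_lt]; exact hp⟩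
  · rintro ⟨hg, hL, hR⟩
    have hab := sd_of_mem hT hθ
    rcases vtx_cases θ.src with hs | hs | ⟨a, hs⟩
    · rcases vtx_cases θ.tgt with ht | ht | ⟨m, ht⟩
      · exact absurd θ.lt (by rw [hs, ht]; exact lt_irrefl _)
      · exact absurd (arc_ext hs ht) hg
      · have hfin := Set.not_infinite.1 (hL m (arc_ext hs ht))
        rw [hs, ht] at hab
        obtain ⟨N, hN⟩ := hfin.bddBelow
        obtain ⟨c, hc1, hc2⟩ := inner_left hT hab (vBot_lt_vInt _)
          ⟨min N (m-1), fun n hn _ => by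
            rcases sd_cases hT hn with h | ⟨k, h1, h2⟩
            · exact (min_le_left _ _).trans (hN h)
            · have := vInt_inj h1
              have := vInt_inj h2
              omega⟩
        obtain ⟨d, hd1, hd2⟩ := outer_right hT hab ⟨vTop, vInt_lt_vTop m, sd_generic T⟩
        exact flip_right hT hθ (c := c) (d := d) (by rwa [hs]) (by rwa [ht]) (by rwa [ht]) (by rwa [hs])
    · exact absurd θ.lt (by rw [hs]; exact not_lt.mpr (le_vTop _))
    · rcases vtx_cases θ.tgt with ht | ht | ⟨m, ht⟩
      · exact absurd θ.lt (by rw [ht]; exact not_lt.mpr (vBot_le _))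
      · have hfin := Set.not_infinite.1 (hR a (arc_ext hs ht))
        rw [hs, ht] at hab
        obtain ⟨N, hN⟩ := hfin.bddAbove
        obtain ⟨c, hc1, hc2⟩ := inner_right hT hab (vInt_lt_vTop _)
          ⟨max N (a+1), fun n hn _ => by
            rcases sd_cases hT hn with h | ⟨k, h1, h2⟩
            · exact (hN h).trans (le_max_left _ _)
            · have := vInt_inj h1
              have := vInt_inj h2
              omega⟩
        obtain ⟨d, hd1, hd2⟩ := outer_left hT hab ⟨vBot, vBot_lt_vInt a, sd_generic T⟩
        exact flip_left hT hθ (c := c) (d := d) (by rwa [hs]) (by rwa [ht]) (by rwa [hs]) (by rwa [ht])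
      · have hsep := θ.sep a m hs ht
        rw [hs, ht] at hab
        obtain ⟨c, hc1, hc2⟩ := inner_right hT hab ((vInt_lt _ _).2 (by omega))
          ⟨m, fun n _ hn => ((vInt_lt _ _).1 hn).le⟩
        rcases outer_exists hT hab with h | h
        · obtain ⟨d, hd1, hd2⟩ := outer_left hT hab h
          exact flip_left hT hθ (c := c) (d := d) (by rwa [hs]) (by rwa [ht]) (by rwa [hs]) (by rwa [ht])
        · obtain ⟨d, hd1, hd2⟩ := outer_right hT hab h
          exact flip_right hT hθ (c := c) (d := d) (by rwa [hs]) (by rwa [ht]) (by rwa [ht]) (by rwa [hs])
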